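/- arXiv:1909.08301 — 4 statements merged into one kernel-verified Lean document; each statement's English description precedes it below -/
import Mathlib

section
/- For every integer k ≥ 9, the function s ↦ ζ(2s)^k + ζ(3s)^k has infinitely many zeros in the half-plane Re(s) > 1; that is, the set {s ∈ ℂ : Re(s) > 1 and ζ(2s)^k + ζ(3s)^k = 0} is infinite. -/
open Complex

lemma norm_intervalIntegral_exp_mul_I_le {θ : ℝ} (hθ : θ ≠ 0) (a b : ℝ) :
    ‖∫ t in a..b, cexp (θ * I * t)‖ ≤ 2 / |θ| := by
  have hc : (θ * I : ℂ) ≠ 0 := by simp [hθ]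
  have h (x : ℝ) : ‖cexp (θ * I * x)‖ = 1 := by
    rw [show (θ * I * x : ℂ) = ((θ * x : ℝ) : ℂ) * I by push_cast; ring, norm_exp_ofReal_mul_I]
  rw [integral_exp_mul_complex hc, norm_div]
  have hn : ‖(θ * I : ℂ)‖ = |θ| := by simp
  rw [hn]
  gcongr
  calc _ ≤ ‖cexp (θ * I * b)‖ + ‖cexp (θ * I * a)‖ := norm_sub_le _ _
    _ = 2 := by rw [h, h]; norm_num

/-- A coefficient of an exponential polynomial is bounded by its supremum on a half-line. -/
lemma norm_coeff_le_of_norm_exp_sum_le {ι : Type*} (S : Finset ι) (a : ι → ℂ)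
    {Λ : ι → ℝ} (hΛ : Function.Injective Λ) {L T : ℝ}
    (hL : ∀ t : ℝ, T < t → ‖∑ d ∈ S, a d * cexp (Λ d * I * t)‖ ≤ L) {m : ι} (hm : m ∈ S) :
    ‖a m‖ ≤ L := by
  classical
  set C : ℝ := ∑ d ∈ S.erase m, ‖a d‖ * (2 / |Λ d - Λ m|) with hC
  have key (X : ℝ) (hX : 0 < X) : ‖a m‖ * X ≤ L * X + C := by
    have h1 : ∫ t in T..(T + X), (∑ d ∈ S, a d * cexp (Λ d * I * t)) * cexp (-(Λ m) * I * t)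
        = a m * X + ∑ d ∈ S.erase m,
          a d * ∫ t in T..(T + X), cexp (((Λ d - Λ m : ℝ) : ℂ) * I * t) := by
      have h2 (t : ℝ) : (∑ d ∈ S, a d * cexp (Λ d * I * t)) * cexp (-(Λ m) * I * t)
          = ∑ d ∈ S, a d * cexp (((Λ d - Λ m : ℝ) : ℂ) * I * t) := by
        rw [Finset.sum_mul]
        refine Finset.sum_congr rfl fun d _ ↦ ?_
        rw [mul_assoc, ← Complex.exp_add]
        push_cast
        ring_nf
      simp_rw [h2]
      rw [intervalIntegral.integral_finsetSum]
      · simp_rw [intervalIntegral.integral_const_mul]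
        rw [← Finset.add_sum_erase _ _ hm]
        simp
      · intro d _
        apply Continuous.intervalIntegrable
        fun_prop
    have h3 : ‖∫ t in T..(T + X), (∑ d ∈ S, a d * cexp (Λ d * I * t)) * cexp (-(Λ m) * I * t)‖
        ≤ L * |T + X - T| := by
      apply intervalIntegral.norm_integral_le_of_norm_le_const
      intro t ht
      rw [Set.uIoc_of_le (by linarith)] at ht
      rw [norm_mul, show (-(Λ m) * I * t : ℂ) = ((-(Λ m) * t : ℝ) : ℂ) * I by push_cast; ring,
        norm_exp_ofReal_mul_I, mul_one]
      exact hL t ht.1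
    have h4 : ‖∑ d ∈ S.erase m,
        a d * ∫ t in T..(T + X), cexp (((Λ d - Λ m : ℝ) : ℂ) * I * t)‖ ≤ C := by
      refine norm_sum_le_of_le _ fun d hd ↦ ?_
      rw [norm_mul]
      gcongr
      apply norm_intervalIntegral_exp_mul_I_le
      exact sub_ne_zero.2 (hΛ.ne (Finset.ne_of_mem_erase hd))
    rw [h1, add_sub_cancel_left, abs_of_pos hX] at h3
    have h5 : ‖a m * X‖ = ‖a m‖ * X := by
      rw [norm_mul, Complex.norm_real, Real.norm_of_nonneg hX.le]
    have h6 := norm_sub_le_norm_add (a m * X) (∑ d ∈ S.erase m,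
        a d * ∫ t in T..(T + X), cexp (((Λ d - Λ m : ℝ) : ℂ) * I * t))
    linarith
  by_contra! h
  have hC0 : 0 ≤ C := Finset.sum_nonneg fun d _ ↦ by positivity
  have h7 := key ((C + 1) / (‖a m‖ - L)) (div_pos (by linarith) (by linarith))
  have h8 : (‖a m‖ - L) * ((C + 1) / (‖a m‖ - L)) = C + 1 :=
    mul_div_cancel₀ _ (by linarith)
  linarith

lemma MvPolynomial.eval_exp_eq_sum {σ : Type*} (Q : MvPolynomial σ ℂ) (lam : σ → ℝ) (t : ℝ) :
    MvPolynomial.eval (fun i ↦ cexp (lam i * I * t)) Q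
      = ∑ d ∈ Q.support, Q.coeff d * cexp (((d.sum fun i k ↦ k * lam i : ℝ) : ℂ) * I * t) := by
  rw [MvPolynomial.eval_eq]
  refine Finset.sum_congr rfl fun d _ ↦ ?_
  congr 1
  simp_rw [← Complex.exp_nat_mul]
  rw [← Complex.exp_sum, Finsupp.sum]
  push_cast
  rw [Finset.sum_mul, Finset.sum_mul]
  congr 1
  exact Finset.sum_congr rfl fun i _ ↦ by ring

lemma MvPolynomial.card_support_pow_le {σ : Type*} (P : MvPolynomial σ ℂ)
    {V : Finset σ} (hV : P.vars ⊆ V) {D : ℕ} (hD : ∀ i, P.degreeOf i ≤ D) (M : ℕ) :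
    (P ^ M).support.card ≤ (M * D + 1) ^ V.card := by
  classical
  have h : (P ^ M).support ⊆ V.finsupp fun _ ↦ Finset.range (M * D + 1) := by
    intro d hd
    rw [Finset.mem_finsupp_iff]
    refine ⟨fun i hi ↦ hV (MvPolynomial.vars_pow P M
      ((MvPolynomial.mem_vars_iff_mem_support i).2 ⟨d, hd, hi⟩)), fun i _ ↦ ?_⟩
    have h1 := MvPolynomial.monomial_le_degreeOf i hd
    have h2 := MvPolynomial.degreeOf_pow_le i P M
    have h3 := Nat.mul_le_mul_left M (hD i)
    simp only [Finset.mem_range]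
    omega
  simpa using Finset.card_le_card h

/-- For rationally independent frequencies, an exponential polynomial that is bounded by `L` on a
half-line is bounded by `L` on the whole torus. -/
lemma MvPolynomial.norm_eval_le_of_norm_eval_exp_le {σ : Type*} (P : MvPolynomial σ ℂ)
    {lam : σ → ℝ} (hlam : Function.Injective fun d : σ →₀ ℕ ↦ d.sum fun i k ↦ (k : ℝ) * lam i)
    {L T : ℝ} (hL : ∀ t : ℝ, T < t → ‖MvPolynomial.eval (fun i ↦ cexp (lam i * I * t)) P‖ ≤ L)
    {w : σ → ℂ} (hw : ∀ i, ‖w i‖ = 1) : ‖MvPolynomial.eval w P‖ ≤ L := by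
  have hL0 : 0 ≤ L := (norm_nonneg _).trans (hL (T + 1) (by linarith))
  set D := P.totalDegree
  set n := P.vars.card
  have key (M : ℕ) : ‖MvPolynomial.eval w P‖ ^ M ≤ ((M * D + 1) ^ n : ℕ) * L ^ M := by
    have hco : ∀ d ∈ (P ^ M).support, ‖(P ^ M).coeff d‖ ≤ L ^ M := fun d hd ↦
      norm_coeff_le_of_norm_exp_sum_le (T := T) _ (fun d ↦ (P ^ M).coeff d) hlam (fun t ht ↦ by
        rw [← MvPolynomial.eval_exp_eq_sum, map_pow, norm_pow]
        exact pow_le_pow_left₀ (norm_nonneg _) (hL t ht) M) hd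
    rw [← norm_pow, ← map_pow, MvPolynomial.eval_eq]
    calc _ ≤ ∑ d ∈ (P ^ M).support, L ^ M := norm_sum_le_of_le _ fun d hd ↦ by
            rw [norm_mul, norm_prod]
            simpa [hw] using hco d hd
      _ = (P ^ M).support.card * L ^ M := by simp
      _ ≤ _ := by
        gcongr
        exact MvPolynomial.card_support_pow_le P subset_rfl
          (fun i ↦ MvPolynomial.degreeOf_le_totalDegree P i) M
  by_contra! h
  have ha := hL0.trans_lt h
  have hr : |L / ‖MvPolynomial.eval w P‖| < 1 := by
    rw [abs_of_nonneg (by positivity), div_lt_one ha]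
    exact h
  have hlim := (tendsto_pow_const_mul_const_pow_of_abs_lt_one n hr).const_mul ((D + 1 : ℝ) ^ n)
  rw [mul_zero] at hlim
  obtain ⟨M, hM, hM1⟩ := ((hlim.eventually (gt_mem_nhds one_pos)).and
    (Filter.eventually_ge_atTop 1)).exists
  have h1 : (((M * D + 1) ^ n : ℕ) : ℝ) ≤ (D + 1 : ℝ) ^ n * M ^ n := by
    rw [← mul_pow]
    push_cast
    have : (1 : ℝ) ≤ M := by exact_mod_cast hM1
    gcongr
    nlinarith
  have h2 := (key M).trans (mul_le_mul_of_nonneg_right h1 (by positivity))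
  rw [div_pow, ← mul_assoc, mul_div_assoc', div_lt_one (by positivity)] at hM
  linarith

lemma Nat.Primes.injective_sum_mul_neg_log :
    Function.Injective fun d : Nat.Primes →₀ ℕ ↦ d.sum fun p k ↦ (k : ℝ) * (-Real.log p) := by
  intro d e h
  have hlog (d : Nat.Primes →₀ ℕ) : (d.sum fun p k ↦ (k : ℝ) * (-Real.log p))
      = -Real.log ((d.mapDomain ((↑) : Nat.Primes → ℕ)).prod (· ^ ·) : ℕ) := by
    have h1 : (d.mapDomain ((↑) : Nat.Primes → ℕ)).prod (· ^ ·) = ∏ p ∈ d.support, (p : ℕ) ^ d p :=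
      Finsupp.prod_mapDomain_index (fun _ ↦ pow_zero _) fun _ _ _ ↦ pow_add _ _ _
    rw [h1, Nat.cast_prod,
      Real.log_prod (fun p _ ↦ by exact_mod_cast pow_ne_zero _ p.2.ne_zero), Finsupp.sum]
    simp
  have hpr (d : Nat.Primes →₀ ℕ) :
      ∀ p ∈ (d.mapDomain ((↑) : Nat.Primes → ℕ)).support, Nat.Prime p := by
    classical
    intro p hp
    obtain ⟨q, -, rfl⟩ := Finset.mem_image.1 (Finsupp.mapDomain_support hp)
    exact q.2
  have hpos (d : Nat.Primes →₀ ℕ) :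
      (0 : ℝ) < ((d.mapDomain ((↑) : Nat.Primes → ℕ)).prod (· ^ ·) : ℕ) := by
    exact_mod_cast Finset.prod_pos fun p hp ↦ pow_pos (hpr d p hp).pos _
  simp only [hlog, neg_inj] at h
  have h1 := Real.log_injOn_pos (hpos d) (hpos e) h
  have h2 := congrArg Nat.factorization (Nat.cast_injective h1)
  rw [Nat.prod_pow_factorization_eq_self (hpr d), Nat.prod_pow_factorization_eq_self (hpr e)] at h2
  exact Finsupp.mapDomain_injective Nat.Primes.coe_nat_injective h2

lemma exp_neg_log_mul_I_mul {n : ℕ} (hn : n ≠ 0) (t : ℝ) :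
    cexp (((-Real.log n : ℝ) : ℂ) * I * t) = (n : ℂ) ^ (-(t * I)) := by
  rw [Complex.cpow_def_of_ne_zero (by exact_mod_cast hn), ← Complex.natCast_log]
  push_cast
  ring_nf

lemma norm_natCast_cpow_neg_mul_I {n : ℕ} (hn : n ≠ 0) (t : ℝ) :
    ‖(n : ℂ) ^ (-(t * I))‖ = 1 := by
  simp [Complex.norm_natCast_cpow_of_pos (Nat.pos_of_ne_zero hn)]

/-- **Kronecker approximation theorem** for the logarithms of finitely many primes and a common
target. -/
lemma exists_gt_norm_prime_cpow_sub_lt (S : Finset Nat.Primes) {c : ℂ} (hc : ‖c‖ = 1)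
    {δ : ℝ} (hδ : 0 < δ) (T : ℝ) :
    ∃ τ : ℝ, T < τ ∧ ∀ p ∈ S, ‖(p : ℂ) ^ (-(τ * I)) - c‖ < δ := by
  by_contra! hcon
  have hexp (p : Nat.Primes) (t : ℝ) := exp_neg_log_mul_I_mul p.2.ne_zero t
  have hnorm (p : Nat.Primes) (t : ℝ) := norm_natCast_cpow_neg_mul_I p.2.ne_zero t
  have hcc : (starRingEnd ℂ) c * c = 1 := by
    rw [← Complex.normSq_eq_conj_mul_self, Complex.normSq_eq_norm_sq, hc]
    simp
  set P : MvPolynomial Nat.Primes ℂ :=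
    1 + ∑ p ∈ S, MvPolynomial.C ((starRingEnd ℂ) c) * MvPolynomial.X p with hP
  have heval (w : Nat.Primes → ℂ) :
      MvPolynomial.eval w P = 1 + ∑ p ∈ S, (starRingEnd ℂ) c * w p := by
    simp [hP]
  have hclose {u : ℂ} (hu : ‖u‖ = 1) (h : δ ≤ ‖u - c‖) :
      ‖1 + (starRingEnd ℂ) c * u‖ ≤ √(4 - δ ^ 2) := by
    have h1 : ‖1 + (starRingEnd ℂ) c * u‖ = ‖c + u‖ := by
      rw [← one_mul ‖1 + _‖, ← hc, ← norm_mul, mul_add, ← mul_assoc, mul_comm c (starRingEnd ℂ c), hcc]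
      simp
    have h2 := parallelogram_law_with_norm ℝ c u
    rw [norm_sub_rev] at h2
    rw [h1]
    apply Real.le_sqrt_of_sq_le
    have h3 : δ ^ 2 ≤ ‖u - c‖ ^ 2 := pow_le_pow_left₀ hδ.le h 2
    rw [hu, hc] at h2
    nlinarith
  have hlt : √(4 - δ ^ 2) < 2 := by
    rw [Real.sqrt_lt' two_pos]
    nlinarith
  have hbound := MvPolynomial.norm_eval_le_of_norm_eval_exp_le P
    Nat.Primes.injective_sum_mul_neg_log (L := S.card - 1 + √(4 - δ ^ 2)) (T := T) ?_
    (w := fun _ ↦ c) (fun _ ↦ hc)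
  · simp only [heval, hcc, Finset.sum_const, nsmul_eq_mul, mul_one] at hbound
    rw [show (1 + (S.card : ℂ)) = ((1 + S.card : ℝ) : ℂ) by push_cast; rfl, Complex.norm_real,
      Real.norm_of_nonneg (by positivity)] at hbound
    linarith
  · intro t ht
    obtain ⟨p, hp, hpt⟩ := hcon t ht
    rw [heval]
    simp only [hexp]
    rw [← Finset.add_sum_erase _ _ hp, ← add_assoc]
    refine (norm_add_le _ _).trans ?_
    have h1 := hclose (hnorm p t) hpt
    have h2 : ‖∑ q ∈ S.erase p, (starRingEnd ℂ) c * (q : ℂ) ^ (-(t * I))‖ ≤ S.card - 1 := by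
      refine (norm_sum_le_of_le (n := fun _ ↦ 1) _ fun q _ ↦ ?_).trans ?_
      · simp [hnorm, hc]
      · rw [Finset.sum_const, Finset.card_erase_of_mem hp, nsmul_eq_mul, mul_one,
          Nat.cast_sub (Finset.card_pos.2 ⟨p, hp⟩)]
        simp
    linarith

/-- The logarithm of the local factor `(1 - z ^ 3) / (1 - z ^ 2)` of `ζ(2s) / ζ(3s)`,
where `z = p ^ (-s)`. -/
noncomputable def logFactor (z : ℂ) : ℂ := -log (1 - z ^ 2) + log (1 - z ^ 3)

lemma norm_pow_le_half {z : ℂ} (hz : ‖z‖ ≤ 1 / 2) {n : ℕ} (hn : 1 ≤ n) : ‖z ^ n‖ ≤ 1 / 2 := by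
  rw [norm_pow]
  exact (pow_le_of_le_one (norm_nonneg _) (by linarith) (by omega)).trans hz

lemma one_sub_pow_mem_slitPlane {z : ℂ} (hz : ‖z‖ ≤ 1 / 2) {n : ℕ} (hn : 1 ≤ n) :
    1 - z ^ n ∈ slitPlane := by
  have h := mem_slitPlane_of_norm_lt_one (z := -z ^ n)
    (by rw [norm_neg]; linarith [norm_pow_le_half hz hn])
  rwa [← sub_eq_add_neg] at h

lemma norm_logFactor_le {z : ℂ} (hz : ‖z‖ ≤ 1 / 2) : ‖logFactor z‖ ≤ 3 * ‖z‖ ^ 2 := by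
  have h2 := norm_log_one_add_half_le_self (z := -z ^ 2)
    (by rw [norm_neg]; exact norm_pow_le_half hz (by norm_num))
  have h3 := norm_log_one_add_half_le_self (z := -z ^ 3)
    (by rw [norm_neg]; exact norm_pow_le_half hz (by norm_num))
  rw [← sub_eq_add_neg, norm_neg, norm_pow] at h2 h3
  have h4 : ‖z‖ ^ 3 ≤ ‖z‖ ^ 2 := pow_le_pow_of_le_one (norm_nonneg _) (by linarith) (by norm_num)
  have h5 := norm_add_le (-log (1 - z ^ 2)) (log (1 - z ^ 3))
  rw [norm_neg] at h5
  rw [logFactor]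
  linarith

lemma differentiableAt_logFactor {z : ℂ} (hz : ‖z‖ ≤ 1 / 2) : DifferentiableAt ℂ logFactor z := by
  unfold logFactor
  refine DifferentiableAt.add (DifferentiableAt.neg ?_) ?_
  · exact DifferentiableAt.clog (by fun_prop) (one_sub_pow_mem_slitPlane hz (by norm_num))
  · exact DifferentiableAt.clog (by fun_prop) (one_sub_pow_mem_slitPlane hz (by norm_num))

lemma norm_prime_cpow_neg (p : Nat.Primes) (s : ℂ) : ‖(p : ℂ) ^ (-s)‖ = (p : ℝ) ^ (-s.re) := by
  rw [Complex.norm_natCast_cpow_of_pos p.2.pos, neg_re]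

lemma norm_mul_prime_cpow_neg_le (p : Nat.Primes) {c s : ℂ} (hc : ‖c‖ ≤ 1) (hs : 1 ≤ s.re) :
    ‖c * (p : ℂ) ^ (-s)‖ ≤ (p : ℝ)⁻¹ * 2 ^ (1 - s.re) := by
  have hp : (2 : ℝ) ≤ p := by exact_mod_cast p.2.two_le
  rw [norm_mul, norm_prime_cpow_neg]
  calc ‖c‖ * (p : ℝ) ^ (-s.re) ≤ 1 * (p : ℝ) ^ (-s.re) := by gcongr
    _ = (p : ℝ)⁻¹ * (p : ℝ) ^ (1 - s.re) := by
      rw [one_mul, ← Real.rpow_neg_one, ← Real.rpow_add (by linarith)]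
      ring_nf
    _ ≤ _ := by
      gcongr ?_ * ?_
      exact Real.rpow_le_rpow_of_nonpos two_pos hp (by linarith)

lemma norm_mul_prime_cpow_neg_le_inv (p : Nat.Primes) {c s : ℂ} (hc : ‖c‖ ≤ 1) (hs : 1 ≤ s.re) :
    ‖c * (p : ℂ) ^ (-s)‖ ≤ (p : ℝ)⁻¹ := by
  refine (norm_mul_prime_cpow_neg_le p hc hs).trans (mul_le_of_le_one_right (by positivity) ?_)
  exact Real.rpow_le_one_of_one_le_of_nonpos (by norm_num) (by linarith)

lemma norm_mul_prime_cpow_neg_le_half (p : Nat.Primes) {c s : ℂ} (hc : ‖c‖ ≤ 1)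
    (hs : 1 ≤ s.re) : ‖c * (p : ℂ) ^ (-s)‖ ≤ 1 / 2 := by
  refine (norm_mul_prime_cpow_neg_le_inv p hc hs).trans ?_
  rw [one_div]
  exact inv_anti₀ two_pos (by exact_mod_cast p.2.two_le)

lemma summable_prime_inv_sq : Summable fun p : Nat.Primes ↦ 3 * ((p : ℝ)⁻¹) ^ 2 := by
  have h : Summable fun n : ℕ ↦ 3 * ((n : ℝ)⁻¹) ^ 2 := by
    simpa using (Real.summable_nat_pow_inv.2 (by norm_num : 1 < 2)).mul_left 3
  exact h.comp_injective Nat.Primes.coe_nat_injective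

lemma norm_logFactor_prime_le (p : Nat.Primes) {c s : ℂ} (hc : ‖c‖ ≤ 1) (hs : 1 ≤ s.re) :
    ‖logFactor (c * (p : ℂ) ^ (-s))‖ ≤ 3 * ((p : ℝ)⁻¹) ^ 2 := by
  refine (norm_logFactor_le (norm_mul_prime_cpow_neg_le_half p hc hs)).trans ?_
  gcongr
  exact norm_mul_prime_cpow_neg_le_inv p hc hs

/-- The logarithm of the Euler product of `ζ(2s) / ζ(3s)`, twisted by the completely multiplicative
function with value `c` at every prime. -/
noncomputable def twistedLog (c s : ℂ) : ℂ := ∑' p : Nat.Primes, logFactor (c * (p : ℂ) ^ (-s))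

lemma summable_logFactor {c s : ℂ} (hc : ‖c‖ ≤ 1) (hs : 1 ≤ s.re) :
    Summable fun p : Nat.Primes ↦ logFactor (c * (p : ℂ) ^ (-s)) :=
  Summable.of_norm_bounded summable_prime_inv_sq fun p ↦ norm_logFactor_prime_le p hc hs

lemma norm_twistedLog_le {c s : ℂ} (hc : ‖c‖ ≤ 1) (hs : 1 ≤ s.re) :
    ‖twistedLog c s‖ ≤ (∑' p : Nat.Primes, 3 * ((p : ℝ)⁻¹) ^ 2) * 2 ^ (1 - s.re) := by
  refine tsum_of_norm_bounded (summable_prime_inv_sq.hasSum.mul_right _) fun p ↦ ?_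
  refine (norm_logFactor_le (norm_mul_prime_cpow_neg_le_half p hc hs)).trans ?_
  have h1 := norm_mul_prime_cpow_neg_le p hc hs
  have h2 := norm_mul_prime_cpow_neg_le_inv p hc hs
  rw [mul_assoc, sq, sq, mul_assoc]
  gcongr

lemma tendsto_twistedLog {c : ℂ} (hc : ‖c‖ ≤ 1) :
    Filter.Tendsto (fun σ : ℝ ↦ twistedLog c σ) Filter.atTop (nhds 0) := by
  set B := ∑' p : Nat.Primes, 3 * ((p : ℝ)⁻¹) ^ 2
  have h : Filter.Tendsto (fun σ : ℝ ↦ B * (2 : ℝ) ^ (1 - σ)) Filter.atTop (nhds 0) := by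
    have h1 : Filter.Tendsto (fun σ : ℝ ↦ 1 - σ) Filter.atTop Filter.atBot :=
      Filter.tendsto_atBot_add_const_left _ 1 Filter.tendsto_neg_atTop_atBot
    have h2 := (tendsto_rpow_atBot_of_base_gt_one 2 one_lt_two).comp h1
    simpa using h2.const_mul B
  refine squeeze_zero_norm' ?_ h
  filter_upwards [Filter.eventually_ge_atTop 1] with σ hσ
  have h1 := norm_twistedLog_le hc (s := σ) (by simpa using hσ)
  rwa [ofReal_re] at h1

lemma isOpen_one_lt_re : IsOpen {s : ℂ | 1 < s.re} := isOpen_lt continuous_const continuous_re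

lemma differentiableOn_twistedLog {c : ℂ} (hc : ‖c‖ ≤ 1) :
    DifferentiableOn ℂ (twistedLog c) {s | 1 < s.re} := by
  refine differentiableOn_tsum_of_summable_norm summable_prime_inv_sq (fun p s hs ↦ ?_)
    isOpen_one_lt_re fun p s hs ↦ norm_logFactor_prime_le p hc (le_of_lt hs)
  have h1 : DifferentiableAt ℂ (fun s ↦ c * (p : ℂ) ^ (-s)) s :=
    (DifferentiableAt.const_cpow (by fun_prop)
      (Or.inl (by exact_mod_cast p.2.ne_zero))).const_mul c
  exact ((differentiableAt_logFactor (norm_mul_prime_cpow_neg_le_half p hc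
    (le_of_lt hs))).comp s h1).differentiableWithinAt

lemma eventually_twistedLog_ne {c s₀ : ℂ} (hc : ‖c‖ ≤ 1) (hs₀ : 1 < s₀.re)
    (h0 : twistedLog c s₀ ≠ 0) : ∀ᶠ z in nhdsWithin s₀ {s₀}ᶜ, twistedLog c z ≠ twistedLog c s₀ := by
  have han : AnalyticOnNhd ℂ (twistedLog c) {s | 1 < s.re} :=
    (differentiableOn_twistedLog hc).analyticOnNhd isOpen_one_lt_re
  refine ((han s₀ hs₀).eventually_eq_or_eventually_ne analyticAt_const).resolve_left fun h ↦ h0 ?_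
  have heq := han.eqOn_of_preconnected_of_eventuallyEq analyticOnNhd_const
    (convex_halfSpace_re_gt 1).isPreconnected hs₀ h
  refine tendsto_nhds_unique (f := fun σ : ℝ ↦ twistedLog c σ) ?_ (tendsto_twistedLog hc)
  refine tendsto_const_nhds.congr' ?_
  filter_upwards [Filter.eventually_gt_atTop 1] with σ hσ
  exact (heq (by simpa using hσ)).symm

lemma exp_twistedLog_one {s : ℂ} (hs : 1 < s.re) :
    exp (twistedLog 1 s) * riemannZeta (3 * s) = riemannZeta (2 * s) := by
  have hcpow (p : Nat.Primes) (n : ℕ) : (p : ℂ) ^ (-(n * s)) = ((p : ℂ) ^ (-s)) ^ n := by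
    rw [← Complex.cpow_nat_mul]; ring_nf
  have hsum (n : ℕ) (hn : 2 ≤ n) :
      Summable fun p : Nat.Primes ↦ log (1 - ((p : ℂ) ^ (-s)) ^ n) := by
    refine Summable.of_norm_bounded summable_prime_inv_sq fun p ↦ ?_
    have h1 := norm_mul_prime_cpow_neg_le_half p (c := 1) (by simp) hs.le
    have h2 := norm_mul_prime_cpow_neg_le_inv p (c := 1) (by simp) hs.le
    rw [one_mul] at h1 h2
    have h3 := norm_log_one_add_half_le_self (z := -((p : ℂ) ^ (-s)) ^ n)
      (by rw [norm_neg]; exact norm_pow_le_half h1 (by omega))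
    rw [← sub_eq_add_neg, norm_neg, norm_pow] at h3
    have h4 : ‖(p : ℂ) ^ (-s)‖ ^ n ≤ ‖(p : ℂ) ^ (-s)‖ ^ 2 :=
      pow_le_pow_of_le_one (norm_nonneg _) (by linarith) hn
    have h5 : ‖(p : ℂ) ^ (-s)‖ ^ 2 ≤ ((p : ℝ)⁻¹) ^ 2 := by gcongr
    linarith [sq_nonneg ((p : ℝ)⁻¹)]
  have h2 := riemannZeta_eulerProduct_exp_log (s := 2 * s) (by simp; linarith)
  have h3 := riemannZeta_eulerProduct_exp_log (s := 3 * s) (by simp; linarith)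
  have hc2 (p : Nat.Primes) : (p : ℂ) ^ (-(2 * s)) = ((p : ℂ) ^ (-s)) ^ 2 := by
    simpa using hcpow p 2
  have hc3 (p : Nat.Primes) : (p : ℂ) ^ (-(3 * s)) = ((p : ℂ) ^ (-s)) ^ 3 := by
    simpa using hcpow p 3
  simp only [hc2] at h2
  simp only [hc3] at h3
  rw [← h2, ← h3, ← Complex.exp_add]
  congr 1
  simp only [twistedLog, logFactor, one_mul]
  rw [Summable.tsum_add (hsum 2 le_rfl).neg (hsum 3 (by norm_num)), tsum_neg, tsum_neg]
  ring

/-- By Kronecker approximation every twist is uniformly approximated by vertical translates of the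
untwisted function. -/
lemma exists_gt_norm_twistedLog_sub_le {c : ℂ} (hc : ‖c‖ = 1) {ε : ℝ} (hε : 0 < ε) (T : ℝ) :
    ∃ τ : ℝ, T < τ ∧ ∀ s : ℂ, 1 ≤ s.re → ‖twistedLog 1 (s + τ * I) - twistedLog c s‖ ≤ ε := by
  classical
  obtain ⟨S, hS⟩ := ((tendsto_order.1 (tendsto_tsum_compl_atTop_zero
    fun p : Nat.Primes ↦ 3 * ((p : ℝ)⁻¹) ^ 2)).2 (ε / 4) (by linarith)).exists
  have huc : UniformContinuousOn logFactor (Metric.closedBall 0 (1 / 2)) :=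
    (isCompact_closedBall _ _).uniformContinuousOn_of_continuous fun z hz ↦
      (differentiableAt_logFactor (by simpa using hz)).continuousAt.continuousWithinAt
  obtain ⟨δ, hδ, hδS⟩ := Metric.uniformContinuousOn_iff.1 huc (ε / (2 * (S.card + 1)))
    (by positivity)
  obtain ⟨τ, hτ, hτS⟩ := exists_gt_norm_prime_cpow_sub_lt S hc hδ T
  refine ⟨τ, hτ, fun s hs ↦ ?_⟩
  have hs' : 1 ≤ (s + τ * I).re := by simpa using hs
  set f : Nat.Primes → ℂ := fun p ↦
    logFactor (1 * (p : ℂ) ^ (-(s + τ * I))) - logFactor (c * (p : ℂ) ^ (-s)) with hf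
  have hfs : Summable f := (summable_logFactor (by simp) hs').sub (summable_logFactor hc.le hs)
  have hfb (p : Nat.Primes) : ‖f p‖ ≤ 2 * (3 * ((p : ℝ)⁻¹) ^ 2) := by
    have h1 := norm_logFactor_prime_le p (c := 1) (by simp) hs'
    have h2 := norm_logFactor_prime_le p hc.le hs
    exact (norm_sub_le _ _).trans (by linarith)
  have heq : twistedLog 1 (s + τ * I) - twistedLog c s = ∑' p, f p :=
    ((summable_logFactor (by simp) hs').tsum_sub (summable_logFactor hc.le hs)).symm
  have htail : ‖∑' p : {p // p ∉ S}, f p‖ ≤ 2 * (ε / 4) := by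
    refine (tsum_of_norm_bounded ((summable_prime_inv_sq.subtype
      {p | p ∉ S}).hasSum.mul_left 2) fun p ↦ hfb p.1).trans ?_
    gcongr
    exact hS.le
  have hhead : ‖∑ p ∈ S, f p‖ ≤ S.card * (ε / (2 * (S.card + 1))) := by
    rw [← nsmul_eq_mul, ← Finset.sum_const]
    refine norm_sum_le_of_le _ fun p hp ↦ ?_
    have h1 := norm_mul_prime_cpow_neg_le_half p (c := 1) (by simp) hs'
    have h2 := norm_mul_prime_cpow_neg_le_half p hc.le hs
    rw [← dist_eq_norm]
    refine (hδS _ (by simpa using h1) _ (by simpa using h2) ?_).le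
    have h3 : (1 : ℂ) * (p : ℂ) ^ (-(s + τ * I)) = (p : ℂ) ^ (-(τ * I)) * (p : ℂ) ^ (-s) := by
      rw [← Complex.cpow_add _ _ (by exact_mod_cast p.2.ne_zero), one_mul]
      ring_nf
    rw [dist_eq_norm, h3, ← sub_mul, norm_mul]
    have h4 := norm_mul_prime_cpow_neg_le_half p (c := 1) (by simp) hs
    rw [one_mul] at h4
    refine (mul_le_of_le_one_right (norm_nonneg _) (by linarith)).trans_lt (hτS p hp)
  have hcard : S.card * (ε / (2 * (S.card + 1))) ≤ ε / 2 := by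
    rw [mul_div_assoc', div_le_div_iff₀ (by positivity) two_pos]
    nlinarith
  rw [heq, ← hfs.sum_add_tsum_subtype_compl S]
  exact (norm_add_le _ _).trans (by linarith)

/-- A nonzero value taken by some twist in `Re s > 1` is taken infinitely often by the untwisted
function. -/
lemma infinite_setOf_twistedLog_one_eq {c s₀ : ℂ} (hc : ‖c‖ = 1) (hs₀ : 1 < s₀.re)
    (h0 : twistedLog c s₀ ≠ 0) : {s : ℂ | 1 < s.re ∧ twistedLog 1 s = twistedLog c s₀}.Infinite := by
  set v := twistedLog c s₀ with hv
  have hne := eventually_twistedLog_ne hc.le hs₀ h0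
  rw [eventually_nhdsWithin_iff] at hne
  obtain ⟨r, hr, hball⟩ := Metric.nhds_basis_closedBall.eventually_iff.1
    (hne.and (isOpen_one_lt_re.mem_nhds hs₀))
  have hcont : ContinuousOn (fun z ↦ ‖twistedLog c z - v‖) (Metric.sphere s₀ r) :=
    (((differentiableOn_twistedLog hc.le).continuousOn.mono fun z hz ↦
      (hball (Metric.sphere_subset_closedBall hz)).2).sub continuousOn_const).norm
  obtain ⟨z₁, hz₁, hmin⟩ := (isCompact_sphere s₀ r).exists_isMinOn
    (NormedSpace.sphere_nonempty.2 hr.le) hcont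
  set m := ‖twistedLog c z₁ - v‖ with hm
  have hm0 : 0 < m := by
    refine norm_pos_iff.2 (sub_ne_zero.2 ((hball (Metric.sphere_subset_closedBall hz₁)).1 ?_))
    exact Metric.ne_of_mem_sphere hz₁ hr.ne'
  have key (T : ℝ) : ∃ s : ℂ, (1 < s.re ∧ twistedLog 1 s = v) ∧ T < s.im := by
    obtain ⟨τ, hτ, hclose⟩ := exists_gt_norm_twistedLog_sub_le hc
      (lt_min (by positivity : 0 < m / 8) (half_pos (norm_pos_iff.2 h0))) (T - s₀.im + r)
    set g : ℂ → ℂ := fun z ↦ twistedLog 1 (z + τ * I) with hg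
    have hclose1 (s : ℂ) (hs : 1 < s.re) : ‖g s - twistedLog c s‖ ≤ m / 8 :=
      (hclose s hs.le).trans (min_le_left _ _)
    have hg0 : g s₀ ≠ 0 := by
      intro h
      have h1 := (hclose s₀ hs₀.le).trans (min_le_right _ _)
      simp only [hg] at h
      rw [h, zero_sub, norm_neg, ← hv] at h1
      linarith [norm_pos_iff.2 h0]
    have hgd : DifferentiableOn ℂ g {s | 1 < s.re} :=
      (differentiableOn_twistedLog (by simp)).comp (by fun_prop)
        fun z hz ↦ by simpa using hz
    have hcl : DiffContOnCl ℂ g (Metric.ball s₀ r) := by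
      refine DifferentiableOn.diffContOnCl (hgd.mono ?_)
      rw [closure_ball _ hr.ne']
      exact fun z hz ↦ (hball hz).2
    have hfreq : ∃ᶠ z in nhds s₀, g z ≠ g s₀ := by
      have h1 := eventually_twistedLog_ne (c := 1) (s₀ := s₀ + τ * I) (by simp)
        (by simpa using hs₀) hg0
      have h2 : Filter.Tendsto (fun z ↦ z + τ * I) (nhdsWithin s₀ {s₀}ᶜ)
          (nhdsWithin (s₀ + τ * I) {s₀ + τ * I}ᶜ) := by
        refine tendsto_nhdsWithin_iff.2 ⟨(Continuous.tendsto (by fun_prop) s₀).mono_left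
          nhdsWithin_le_nhds, ?_⟩
        filter_upwards [self_mem_nhdsWithin] with z hz
        simpa using hz
      exact (h2.eventually h1).frequently.filter_mono nhdsWithin_le_nhds
    have hsub := hcl.ball_subset_image_closedBall (ε := 3 * m / 4) hr (fun z hz ↦ ?_) hfreq
    · have hvmem : v ∈ Metric.ball (g s₀) (3 * m / 4 / 2) := by
        rw [Metric.mem_ball', dist_eq_norm]
        linarith [hclose1 s₀ hs₀]
      obtain ⟨z, hz, hgz⟩ := hsub hvmem
      refine ⟨z + τ * I, ⟨by simpa using (hball hz).2, hgz⟩, ?_⟩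
      have h1 : |(z - s₀).im| ≤ r := (abs_im_le_norm _).trans (by simpa [dist_eq_norm] using hz)
      have h2 := (abs_le.1 h1).1
      simp at h2 ⊢
      linarith
    · have h1 := hclose1 z (hball (Metric.sphere_subset_closedBall hz)).2
      have h2 := hclose1 s₀ hs₀
      have h3 : m ≤ ‖twistedLog c z - v‖ := hmin hz
      have h4 : twistedLog c z - v
          = (g z - g s₀) - (g z - twistedLog c z) + (g s₀ - v) := by ring
      have h5 := norm_add_le ((g z - g s₀) - (g z - twistedLog c z)) (g s₀ - v)
      have h6 := norm_sub_le (g z - g s₀) (g z - twistedLog c z)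
      rw [h4] at h3
      linarith
  intro hfin
  obtain ⟨T, hT⟩ := (hfin.image im).bddAbove
  obtain ⟨s, hs, hTs⟩ := key T
  exact (hT ⟨s, hs, rfl⟩).not_gt hTs

lemma one_sub_sq_eq (α x : ℝ) : 1 - (-exp (α * I) * x) ^ 2
    = ⟨1 - x ^ 2 * Real.cos (2 * α), -(x ^ 2 * Real.sin (2 * α))⟩ := by
  have h : (-exp (α * I) * x) ^ 2 = (x ^ 2 : ℝ) * exp ((2 * α : ℝ) * I) := by
    rw [mul_pow, neg_sq, ← Complex.exp_nat_mul]
    push_cast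
    ring_nf
  rw [h]
  apply Complex.ext <;> simp [exp_ofReal_mul_I_re, exp_ofReal_mul_I_im, -ofReal_mul, -ofReal_pow]

lemma one_sub_cube_eq (α x : ℝ) : 1 - (-exp (α * I) * x) ^ 3
    = ⟨1 + x ^ 3 * Real.cos (3 * α), x ^ 3 * Real.sin (3 * α)⟩ := by
  have h : (-exp (α * I) * x) ^ 3 = -((x ^ 3 : ℝ) * exp ((3 * α : ℝ) * I)) := by
    rw [mul_pow, Odd.neg_pow (by decide), ← Complex.exp_nat_mul]
    push_cast
    ring_nf
  rw [h, sub_neg_eq_add]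
  apply Complex.ext <;> simp [exp_ofReal_mul_I_re, exp_ofReal_mul_I_im, -ofReal_mul, -ofReal_pow]

lemma norm_one_sub_sq_sq (α x : ℝ) : ‖1 - (-exp (α * I) * x) ^ 2‖ ^ 2
    = 1 - 2 * x ^ 2 * Real.cos (2 * α) + x ^ 4 := by
  rw [one_sub_sq_eq, ← Complex.normSq_eq_norm_sq, Complex.normSq_mk]
  linear_combination x ^ 4 * Real.sin_sq_add_cos_sq (2 * α)

lemma norm_one_sub_cube_sq (α x : ℝ) : ‖1 - (-exp (α * I) * x) ^ 3‖ ^ 2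
    = 1 + 2 * x ^ 3 * Real.cos (3 * α) + x ^ 6 := by
  rw [one_sub_cube_eq, ← Complex.normSq_eq_norm_sq, Complex.normSq_mk]
  linear_combination x ^ 6 * Real.sin_sq_add_cos_sq (3 * α)

lemma re_logFactor (z : ℂ) : (logFactor z).re
    = (Real.log (‖1 - z ^ 3‖ ^ 2) - Real.log (‖1 - z ^ 2‖ ^ 2)) / 2 := by
  rw [logFactor, add_re, neg_re, log_re, log_re, Real.log_pow, Real.log_pow]
  push_cast
  ring

lemma norm_neg_exp_mul_I (α : ℝ) : ‖-exp (α * I)‖ = 1 := by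
  rw [norm_neg, norm_exp_ofReal_mul_I]

lemma norm_one_sub_pow_sq_pos {α x : ℝ} (hx0 : 0 < x) (hx : x ≤ 1 / 2) {n : ℕ} (hn : 1 ≤ n) :
    0 < ‖1 - (-exp (α * I) * x) ^ n‖ ^ 2 := by
  have h1 : ‖(-exp (α * I) * x) ^ n‖ ≤ 1 / 2 := by
    rw [norm_pow, norm_mul, norm_neg_exp_mul_I, one_mul, Complex.norm_real,
      Real.norm_of_nonneg hx0.le]
    exact (pow_le_of_le_one hx0.le (by linarith) (by omega)).trans hx
  have h2 := norm_sub_norm_le 1 ((-exp (α * I) * x) ^ n)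
  rw [norm_one] at h2
  exact pow_pos (by linarith) 2

lemma re_logFactor_strictAntiOn {x : ℝ} (hx0 : 0 < x) (hx : x ≤ 1 / 2) :
    StrictAntiOn (fun α : ℝ ↦ (logFactor (-exp (α * I) * x)).re)
      (Set.Icc (Real.pi / 6) (Real.pi / 4)) := by
  intro α hα β hβ hαβ
  have hpi := Real.pi_pos
  obtain ⟨hα1, hα2⟩ := hα
  obtain ⟨hβ1, hβ2⟩ := hβ
  have h2 : Real.cos (2 * β) < Real.cos (2 * α) :=
    Real.strictAntiOn_cos ⟨by linarith, by linarith⟩ ⟨by linarith, by linarith⟩ (by linarith)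
  have h3 : Real.cos (3 * β) < Real.cos (3 * α) :=
    Real.strictAntiOn_cos ⟨by linarith, by linarith⟩ ⟨by linarith, by linarith⟩ (by linarith)
  have h4 : Real.log (‖1 - (-exp (α * I) * x) ^ 2‖ ^ 2)
      < Real.log (‖1 - (-exp (β * I) * x) ^ 2‖ ^ 2) := by
    apply Real.log_lt_log (norm_one_sub_pow_sq_pos hx0 hx (by norm_num))
    rw [norm_one_sub_sq_sq, norm_one_sub_sq_sq]
    have := mul_lt_mul_of_pos_left h2 (by positivity : 0 < 2 * x ^ 2)
    linarith
  have h5 : Real.log (‖1 - (-exp (β * I) * x) ^ 3‖ ^ 2)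
      < Real.log (‖1 - (-exp (α * I) * x) ^ 3‖ ^ 2) := by
    apply Real.log_lt_log (norm_one_sub_pow_sq_pos hx0 hx (by norm_num))
    rw [norm_one_sub_cube_sq, norm_one_sub_cube_sq]
    have := mul_lt_mul_of_pos_left h3 (by positivity : 0 < 2 * x ^ 3)
    linarith
  simp only [re_logFactor]
  linarith

lemma re_logFactor_pi_div_six_pos {x : ℝ} (hx0 : 0 < x) (hx : x ≤ 1 / 2) :
    0 < (logFactor (-exp ((Real.pi / 6 : ℝ) * I) * x)).re := by
  rw [re_logFactor]
  apply half_pos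
  rw [sub_pos]
  apply Real.log_lt_log (norm_one_sub_pow_sq_pos hx0 hx (by norm_num))
  rw [norm_one_sub_cube_sq, norm_one_sub_sq_sq, show 2 * (Real.pi / 6) = Real.pi / 3 by ring,
    show 3 * (Real.pi / 6) = Real.pi / 2 by ring, Real.cos_pi_div_three, Real.cos_pi_div_two]
  have h1 : x ^ 2 ≤ 1 / 4 := by nlinarith
  have h2 : 0 < x ^ 2 := by positivity
  have h3 : 0 ≤ x ^ 6 := by positivity
  nlinarith

lemma re_logFactor_pi_div_four_neg {x : ℝ} (hx0 : 0 < x) (hx : x ≤ 1 / 2) :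
    (logFactor (-exp ((Real.pi / 4 : ℝ) * I) * x)).re < 0 := by
  rw [re_logFactor]
  refine div_neg_of_neg_of_pos ?_ two_pos
  rw [sub_neg]
  apply Real.log_lt_log (norm_one_sub_pow_sq_pos hx0 hx (by norm_num))
  rw [norm_one_sub_cube_sq, norm_one_sub_sq_sq, show 2 * (Real.pi / 4) = Real.pi / 2 by ring,
    show 3 * (Real.pi / 4) = Real.pi - Real.pi / 4 by ring, Real.cos_pi_sub,
    Real.cos_pi_div_four, Real.cos_pi_div_two]
  have h1 : (1.4 : ℝ) < √2 := Real.lt_sqrt_of_sq_lt (by norm_num)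
  have h2 : 0 < x ^ 3 := by positivity
  have h3 : x ^ 3 ≤ 1 / 8 := by
    calc x ^ 3 ≤ (1 / 2) ^ 3 := by gcongr
      _ = 1 / 8 := by norm_num
  have h4 : 0 < x ^ 4 := by positivity
  nlinarith

lemma im_div_norm_le_arg {w : ℂ} (h : 0 ≤ w.im) : w.im / ‖w‖ ≤ arg w := by
  rw [← Complex.sin_arg]
  exact Real.sin_le (arg_nonneg_iff.2 h)

lemma arg_le_im_div_norm {w : ℂ} (h : w.im < 0) : arg w ≤ w.im / ‖w‖ := by
  rw [← Complex.sin_arg]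
  have h1 := Real.sin_le (x := -arg w) (by linarith [arg_neg_iff.2 h])
  rw [Real.sin_neg] at h1
  linarith

lemma le_im_logFactor {x : ℝ} (hx0 : 0 < x) {α : ℝ}
    (hα : α ∈ Set.Icc (Real.pi / 6) (Real.pi / 4)) :
    0.86 * x ^ 2 / (1 + x ^ 4) + 0.7 * x ^ 3 / (1 + x ^ 6)
      ≤ (logFactor (-exp (α * I) * x)).im := by
  obtain ⟨hα1, hα2⟩ := hα
  have hpi := Real.pi_pos
  have hs2 : 0.86 ≤ Real.sin (2 * α) := by
    have h1 : Real.sin (Real.pi / 3) ≤ Real.sin (2 * α) :=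
      Real.sin_le_sin_of_le_of_le_pi_div_two (by linarith) (by linarith) (by linarith)
    rw [Real.sin_pi_div_three] at h1
    have h2 : (1.72 : ℝ) < √3 := Real.lt_sqrt_of_sq_lt (by norm_num)
    linarith
  have hs3 : 0.7 ≤ Real.sin (3 * α) := by
    have h1 : Real.cos (Real.pi / 4) ≤ Real.cos (3 * α - Real.pi / 2) :=
      Real.cos_le_cos_of_nonneg_of_le_pi (by linarith) (by linarith) (by linarith)
    rw [Real.cos_sub_pi_div_two, Real.cos_pi_div_four] at h1
    have h2 : (1.4 : ℝ) < √2 := Real.lt_sqrt_of_sq_lt (by norm_num)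
    linarith
  have hc2 : 0 ≤ Real.cos (2 * α) :=
    Real.cos_nonneg_of_neg_pi_div_two_le_of_le (by linarith) (by linarith)
  have hc3 : Real.cos (3 * α) ≤ 0 :=
    Real.cos_nonpos_of_pi_div_two_le_of_le (by linarith) (by linarith)
  have hn2 : ‖1 - (-exp (α * I) * x) ^ 2‖ ≤ 1 + x ^ 4 := by
    refine le_of_sq_le_sq ?_ (by positivity)
    rw [norm_one_sub_sq_sq]
    have : 0 ≤ x ^ 2 * Real.cos (2 * α) := by positivity
    have : 0 ≤ x ^ 4 := by positivity
    nlinarith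
  have hn3 : ‖1 - (-exp (α * I) * x) ^ 3‖ ≤ 1 + x ^ 6 := by
    refine le_of_sq_le_sq ?_ (by positivity)
    rw [norm_one_sub_cube_sq]
    have : x ^ 3 * Real.cos (3 * α) ≤ 0 := mul_nonpos_of_nonneg_of_nonpos (by positivity) hc3
    have : 0 ≤ x ^ 6 := by positivity
    nlinarith
  have him2 : (1 - (-exp (α * I) * x) ^ 2).im = -(x ^ 2 * Real.sin (2 * α)) := by
    rw [one_sub_sq_eq]
  have him3 : (1 - (-exp (α * I) * x) ^ 3).im = x ^ 3 * Real.sin (3 * α) := by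
    rw [one_sub_cube_eq]
  have h2pos : 0 < x ^ 2 * Real.sin (2 * α) := mul_pos (by positivity) (by linarith)
  have h3pos : 0 < x ^ 3 * Real.sin (3 * α) := mul_pos (by positivity) (by linarith)
  have h2 := arg_le_im_div_norm (w := 1 - (-exp (α * I) * x) ^ 2) (by rw [him2]; linarith)
  have h3 := im_div_norm_le_arg (w := 1 - (-exp (α * I) * x) ^ 3) (by rw [him3]; linarith)
  have hp2 : 0 < ‖1 - (-exp (α * I) * x) ^ 2‖ := norm_pos_iff.2 fun h ↦ by
    rw [h, zero_im] at him2; linarith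
  have hp3 : 0 < ‖1 - (-exp (α * I) * x) ^ 3‖ := norm_pos_iff.2 fun h ↦ by
    rw [h, zero_im] at him3; linarith
  rw [him2, neg_div] at h2
  rw [him3] at h3
  have h2' : 0.86 * x ^ 2 / (1 + x ^ 4)
      ≤ x ^ 2 * Real.sin (2 * α) / ‖1 - (-exp (α * I) * x) ^ 2‖ := by
    rw [mul_comm]
    gcongr
  have h3' : 0.7 * x ^ 3 / (1 + x ^ 6)
      ≤ x ^ 3 * Real.sin (3 * α) / ‖1 - (-exp (α * I) * x) ^ 3‖ := by
    rw [mul_comm]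
    gcongr
  rw [logFactor, add_im, neg_im, log_im, log_im]
  linarith

lemma natCast_cpow_neg_ofReal (n : ℕ) (σ : ℝ) : (n : ℂ) ^ (-(σ : ℂ)) = ((n : ℝ) ^ (-σ) : ℝ) := by
  rw [Complex.ofReal_cpow n.cast_nonneg]
  simp

lemma prime_rpow_neg_le_half (p : Nat.Primes) {σ : ℝ} (hσ : 1 ≤ σ) :
    (p : ℝ) ^ (-σ) ≤ 1 / 2 := by
  have h := norm_mul_prime_cpow_neg_le_half p (c := 1) (s := σ) (by simp) (by simpa using hσ)
  rwa [one_mul, Complex.norm_natCast_cpow_of_pos p.2.pos, neg_re, ofReal_re] at h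

lemma prime_rpow_neg_pos (p : Nat.Primes) (σ : ℝ) : 0 < (p : ℝ) ^ (-σ) :=
  Real.rpow_pos_of_pos (by exact_mod_cast p.2.pos) _

lemma summable_logFactor_rpow (α : ℝ) {σ : ℝ} (hσ : 1 ≤ σ) :
    Summable fun p : Nat.Primes ↦ logFactor (-exp (α * I) * ((p : ℝ) ^ (-σ) : ℝ)) := by
  simpa only [natCast_cpow_neg_ofReal] using
    summable_logFactor (norm_neg_exp_mul_I α).le (s := σ) (by simpa using hσ)

lemma re_twistedLog (α : ℝ) {σ : ℝ} (hσ : 1 ≤ σ) : (twistedLog (-exp (α * I)) σ).re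
    = ∑' p : Nat.Primes, (logFactor (-exp (α * I) * ((p : ℝ) ^ (-σ) : ℝ))).re := by
  simp only [twistedLog, natCast_cpow_neg_ofReal]
  exact re_tsum (summable_logFactor_rpow α hσ)

lemma im_twistedLog (α : ℝ) {σ : ℝ} (hσ : 1 ≤ σ) : (twistedLog (-exp (α * I)) σ).im
    = ∑' p : Nat.Primes, (logFactor (-exp (α * I) * ((p : ℝ) ^ (-σ) : ℝ))).im := by
  simp only [twistedLog, natCast_cpow_neg_ofReal]
  exact im_tsum (summable_logFactor_rpow α hσ)

lemma summable_re_logFactor (α : ℝ) {σ : ℝ} (hσ : 1 ≤ σ) :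
    Summable fun p : Nat.Primes ↦ (logFactor (-exp (α * I) * ((p : ℝ) ^ (-σ) : ℝ))).re :=
  (Complex.hasSum_re (summable_logFactor_rpow α hσ).hasSum).summable

lemma summable_im_logFactor (α : ℝ) {σ : ℝ} (hσ : 1 ≤ σ) :
    Summable fun p : Nat.Primes ↦ (logFactor (-exp (α * I) * ((p : ℝ) ^ (-σ) : ℝ))).im :=
  (Complex.hasSum_im (summable_logFactor_rpow α hσ).hasSum).summable

lemma re_twistedLog_strictAntiOn {σ : ℝ} (hσ : 1 ≤ σ) :
    StrictAntiOn (fun α : ℝ ↦ (twistedLog (-exp (α * I)) σ).re)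
      (Set.Icc (Real.pi / 6) (Real.pi / 4)) := by
  intro α hα β hβ hαβ
  have h (p : Nat.Primes) :=
    re_logFactor_strictAntiOn (prime_rpow_neg_pos p σ) (prime_rpow_neg_le_half p hσ) hα hβ hαβ
  simp only [re_twistedLog _ hσ]
  exact Summable.tsum_lt_tsum (i := ⟨2, Nat.prime_two⟩) (fun p ↦ (h p).le) (h _)
    (summable_re_logFactor β hσ) (summable_re_logFactor α hσ)

lemma re_twistedLog_pi_div_six_pos {σ : ℝ} (hσ : 1 ≤ σ) :
    0 < (twistedLog (-exp ((Real.pi / 6 : ℝ) * I)) σ).re := by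
  have h (p : Nat.Primes) :=
    re_logFactor_pi_div_six_pos (prime_rpow_neg_pos p σ) (prime_rpow_neg_le_half p hσ)
  rw [re_twistedLog _ hσ]
  exact (summable_re_logFactor _ hσ).tsum_pos (fun p ↦ (h p).le) ⟨2, Nat.prime_two⟩ (h _)

lemma re_twistedLog_pi_div_four_neg {σ : ℝ} (hσ : 1 ≤ σ) :
    (twistedLog (-exp ((Real.pi / 4 : ℝ) * I)) σ).re < 0 := by
  have h (p : Nat.Primes) :=
    re_logFactor_pi_div_four_neg (prime_rpow_neg_pos p σ) (prime_rpow_neg_le_half p hσ)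
  rw [re_twistedLog _ hσ, ← tsum_zero (α := ℝ) (β := Nat.Primes)]
  exact Summable.tsum_lt_tsum (i := ⟨2, Nat.prime_two⟩) (fun p ↦ (h p).le) (h _)
    (summable_re_logFactor _ hσ) summable_zero

lemma pi_div_nine_lt_im_twistedLog_one {α : ℝ} (hα : α ∈ Set.Icc (Real.pi / 6) (Real.pi / 4)) :
    Real.pi / 9 < (twistedLog (-exp (α * I)) (1 : ℝ)).im := by
  classical
  have h (p : Nat.Primes) := le_im_logFactor (prime_rpow_neg_pos p 1) hα
  obtain ⟨q, hq⟩ : ∃ q : Nat.Primes, (q : ℕ) = 2 := ⟨⟨2, Nat.prime_two⟩, rfl⟩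
  obtain ⟨r, hr⟩ : ∃ r : Nat.Primes, (r : ℕ) = 3 := ⟨⟨3, Nat.prime_three⟩, rfl⟩
  have hne : q ≠ r := fun h ↦ by simp [h, hr] at hq
  have h1 := (summable_im_logFactor α le_rfl).sum_le_tsum {q, r}
    fun p _ ↦ le_trans (by have := prime_rpow_neg_pos p 1; positivity) (h p)
  rw [Finset.sum_pair hne, ← im_twistedLog α le_rfl] at h1
  refine lt_of_lt_of_le ?_ ((add_le_add (h q) (h r)).trans h1)
  rw [hq, hr]
  simp only [Real.rpow_neg_one]
  have := Real.pi_lt_d2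
  norm_num
  linarith

lemma continuousOn_twistedLog :
    ContinuousOn (fun q : ℝ × ℝ ↦ twistedLog (-exp (q.2 * I)) q.1) {q | 1 ≤ q.1} := by
  refine continuousOn_tsum (fun p ↦ ?_) summable_prime_inv_sq fun p q hq ↦
    norm_logFactor_prime_le p (norm_neg_exp_mul_I _).le (by simpa using hq)
  intro q hq
  have hp : (p : ℂ) ≠ 0 := by exact_mod_cast p.2.ne_zero
  have h1 : Continuous fun q : ℝ × ℝ ↦ -exp (q.2 * I) * (p : ℂ) ^ (-(q.1 : ℂ)) := by
    refine Continuous.mul (by fun_prop) (Continuous.const_cpow (by fun_prop) (Or.inl hp))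
  exact ((differentiableAt_logFactor (norm_mul_prime_cpow_neg_le_half p
    (norm_neg_exp_mul_I _).le (by simpa using hq))).continuousAt.comp
      (f := fun q : ℝ × ℝ ↦ -exp (q.2 * I) * (p : ℂ) ^ (-(q.1 : ℂ)))
      h1.continuousAt).continuousWithinAt

lemma exists_re_twistedLog_eq_zero {σ : ℝ} (hσ : 1 ≤ σ) :
    ∃ α ∈ Set.Icc (Real.pi / 6) (Real.pi / 4), (twistedLog (-exp (α * I)) σ).re = 0 := by
  have hpi := Real.pi_pos
  have hcont : ContinuousOn (fun α : ℝ ↦ (twistedLog (-exp (α * I)) σ).re)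
      (Set.Icc (Real.pi / 6) (Real.pi / 4)) :=
    continuous_re.comp_continuousOn (continuousOn_twistedLog.comp
      (f := fun α : ℝ ↦ (σ, α)) (by fun_prop) fun _ _ ↦ hσ)
  exact intermediate_value_Icc' (by linarith) hcont
    ⟨(re_twistedLog_pi_div_four_neg hσ).le, (re_twistedLog_pi_div_six_pos hσ).le⟩

/-- Along the curve where the twisted function is purely imaginary, its imaginary part takes every
value in `(0, π / 9]`. -/
lemma exists_twistedLog_eq_mul_I {v : ℝ} (hv0 : 0 < v) (hv : v ≤ Real.pi / 9) :
    ∃ σ : ℝ, 1 < σ ∧ ∃ α : ℝ, twistedLog (-exp (α * I)) σ = v * I := by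
  set J := Set.Icc (Real.pi / 6) (Real.pi / 4)
  set B := ∑' p : Nat.Primes, 3 * ((p : ℝ)⁻¹) ^ 2
  obtain ⟨M, hM1, hM⟩ : ∃ M : ℝ, 1 ≤ M ∧ B * (2 : ℝ) ^ (1 - M) < v := by
    have h1 : Filter.Tendsto (fun σ : ℝ ↦ 1 - σ) Filter.atTop Filter.atBot :=
      Filter.tendsto_atBot_add_const_left _ 1 Filter.tendsto_neg_atTop_atBot
    have h2 := ((tendsto_rpow_atBot_of_base_gt_one 2 one_lt_two).comp h1).const_mul B
    rw [mul_zero] at h2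
    exact ((Filter.eventually_ge_atTop 1).and (h2.eventually (gt_mem_nhds hv0))).exists
  have hK : IsCompact (Set.Icc 1 M ×ˢ J) := isCompact_Icc.prod isCompact_Icc
  have hcont : ContinuousOn (fun q : ℝ × ℝ ↦ twistedLog (-exp (q.2 * I)) q.1)
      (Set.Icc 1 M ×ˢ J) := continuousOn_twistedLog.mono fun q hq ↦ hq.1.1
  have hproj (C : Set ℂ) (hC : IsClosed C) : IsClosed (Prod.fst '' ((Set.Icc 1 M ×ˢ J) ∩
      (fun q : ℝ × ℝ ↦ twistedLog (-exp (q.2 * I)) q.1) ⁻¹' C)) :=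
    ((hK.of_isClosed_subset (hcont.preimage_isClosed_of_isClosed hK.isClosed hC)
      Set.inter_subset_left).image continuous_fst).isClosed
  have hre : IsClosed {z : ℂ | z.re = 0} := isClosed_eq continuous_re continuous_const
  have hup := hproj _ (hre.inter (isClosed_le continuous_const continuous_im :
    IsClosed {z : ℂ | v ≤ z.im}))
  have hlow := hproj _ (hre.inter (isClosed_le continuous_im continuous_const :
    IsClosed {z : ℂ | z.im ≤ v}))
  have hne := isPreconnected_closed_iff.1 (isPreconnected_Icc (a := 1) (b := M))
    _ _ hup hlow ?_ ?_ ?_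
  · obtain ⟨σ, hσ, hσup, hσlow⟩ := hne
    obtain ⟨⟨_, α⟩, ⟨⟨-, hα⟩, hα0, hαv⟩, rfl⟩ := hσup
    obtain ⟨⟨σ, β⟩, ⟨⟨-, hβ⟩, hβ0, hβv⟩, rfl⟩ := hσlow
    have hαβ : α = β := (re_twistedLog_strictAntiOn hσ.1).injOn hα hβ (hα0.trans hβ0.symm)
    subst hαβ
    have him : (twistedLog (-exp (α * I)) σ).im = v := le_antisymm hβv hαv
    refine ⟨σ, lt_of_le_of_ne hσ.1 ?_, α, Complex.ext ?_ ?_⟩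
    · rintro rfl
      linarith [pi_div_nine_lt_im_twistedLog_one hα]
    · simpa using hα0
    · simpa using him
  · intro σ hσ
    obtain ⟨α, hα, hα0⟩ := exists_re_twistedLog_eq_zero hσ.1
    rcases le_total v (twistedLog (-exp (α * I)) σ).im with h | h
    · exact Or.inl ⟨(σ, α), ⟨⟨hσ, hα⟩, hα0, h⟩, rfl⟩
    · exact Or.inr ⟨(σ, α), ⟨⟨hσ, hα⟩, hα0, h⟩, rfl⟩
  · obtain ⟨α, hα, hα0⟩ := exists_re_twistedLog_eq_zero le_rfl
    exact ⟨1, ⟨le_rfl, hM1⟩, (1, α), ⟨⟨⟨le_rfl, hM1⟩, hα⟩, hα0,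
      hv.trans (pi_div_nine_lt_im_twistedLog_one hα).le⟩, rfl⟩
  · obtain ⟨α, hα, hα0⟩ := exists_re_twistedLog_eq_zero hM1
    refine ⟨M, ⟨hM1, le_rfl⟩, (M, α), ⟨⟨⟨hM1, le_rfl⟩, hα⟩, hα0, ?_⟩, rfl⟩
    have h := norm_twistedLog_le (norm_neg_exp_mul_I α).le (s := M) (by simpa using hM1)
    exact (im_le_norm _).trans (h.trans (by rw [ofReal_re]; exact hM.le))

/-- **Theorem.** For every integer `k ≥ 9`, `ζ(2s)^k + ζ(3s)^k` has infinitely many zeros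
in the half-plane `Re s > 1`. -/
theorem zeta_pow_two_three_infinite_zeros (k : ℕ) (hk : 9 ≤ k) :
    {s : ℂ | 1 < s.re ∧
      riemannZeta (2 * s) ^ k + riemannZeta (3 * s) ^ k = 0}.Infinite := by
  have hk0 : (0 : ℝ) < k := by exact_mod_cast (by omega : 0 < k)
  have hv0 : 0 < Real.pi / k := div_pos Real.pi_pos hk0
  obtain ⟨σ, hσ, α, hα⟩ := exists_twistedLog_eq_mul_I hv0
    (div_le_div_of_nonneg_left Real.pi_pos.le (by norm_num) (by exact_mod_cast hk))
  have h0 : twistedLog (-exp (α * I)) σ ≠ 0 := by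
    rw [hα]
    exact mul_ne_zero (ofReal_ne_zero.2 hv0.ne') I_ne_zero
  refine (infinite_setOf_twistedLog_one_eq (norm_neg_exp_mul_I α) (s₀ := σ) (by simpa using hσ)
    h0).mono ?_
  rintro s ⟨hs, hsv⟩
  refine ⟨hs, ?_⟩
  have hexp : exp (twistedLog 1 s) ^ k = -1 := by
    rw [hsv, hα, ← Complex.exp_nat_mul, ← Complex.exp_pi_mul_I]
    congr 1
    have : (k : ℂ) ≠ 0 := by exact_mod_cast hk0.ne'
    push_cast
    field_simp
  rw [← exp_twistedLog_one hs, mul_pow, hexp]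
  ring
end

section
/- For every integer k with 1 ≤ k ≤ 5, the function s ↦ ζ(2s)^k + ζ(3s)^k has no zeros in the half-plane Re(s) > 1; that is, for every s ∈ ℂ with Re(s) > 1 one has ζ(2s)^k + ζ(3s)^k ≠ 0. -/
open Complex

/-- The two halves of the sector condition `|Im w| ≤ T * Re w` at
`w = (1 + z + z ^ 2) * (1 + conj z)` follow from nonnegativity of a quadratic polynomial. -/
lemma cubic_nonneg_of_quadratic_nonneg {ρ T c x y : ℝ} (hT : 0 ≤ T) (hρ : 0 ≤ ρ)
    (hc : ρ * (1 + T) ≤ c) (hxy : x ^ 2 + y ^ 2 ≤ ρ ^ 2)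
    (hQ : 0 ≤ T * (1 + 2 * x + 2 * x ^ 2) + T * ρ ^ 2 * x - 2 * x * y - ρ ^ 2 * y
      + c * (x ^ 2 + y ^ 2 - ρ ^ 2)) :
    y * (2 * x + (x ^ 2 + y ^ 2)) ≤ T * (1 + 2 * x + 2 * x ^ 2 + x * (x ^ 2 + y ^ 2)) := by
  have hx : x ≤ ρ := abs_le_of_sq_le_sq' (by nlinarith [sq_nonneg y]) hρ |>.2
  have hy : -ρ ≤ y := abs_le_of_sq_le_sq' (by nlinarith [sq_nonneg x]) hρ |>.1
  have h : 0 ≤ (ρ ^ 2 - (x ^ 2 + y ^ 2)) * (c + y - T * x) :=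
    mul_nonneg (by linarith) (by nlinarith [mul_le_mul_of_nonneg_left hx hT])
  linarith

lemma Complex.abs_arg_le_arctan {w : ℂ} {T : ℝ} (hre : 0 < w.re) (h : |w.im| ≤ T * w.re) :
    |arg w| ≤ Real.arctan T := by
  have harg := abs_arg_lt_pi_div_two_iff.2 (Or.inl hre)
  rw [abs_lt] at harg
  have h1 : arg w = Real.arctan (w.im / w.re) := by
    rw [← tan_arg, Real.arctan_tan harg.1 harg.2]
  rw [abs_le] at h
  rw [h1, abs_le, ← Real.arctan_neg]
  constructor <;> apply Real.arctan_strictMono.monotone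
  · rw [le_div_iff₀ hre]; linarith
  · rw [div_le_iff₀ hre]; linarith

lemma abs_arg_sub_arg_le_arctan {ρ T c : ℝ} {z : ℂ} (hT : 0 ≤ T) (hρ0 : 0 ≤ ρ) (hρ : ρ ≤ 1 / 2)
    (hc : ρ * (1 + T) ≤ c) (hz : ‖z‖ ≤ ρ)
    (hQ : ∀ x y : ℝ, 0 ≤ T * (1 + 2 * x + 2 * x ^ 2) + T * ρ ^ 2 * x - 2 * x * y - ρ ^ 2 * y
      + c * (x ^ 2 + y ^ 2 - ρ ^ 2)) :
    |arg (1 - z ^ 3) - arg (1 - z ^ 2)| ≤ Real.arctan T := by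
  have hxy : z.re ^ 2 + z.im ^ 2 ≤ ρ ^ 2 := by
    have h := pow_le_pow_left₀ (norm_nonneg z) hz 2
    rw [Complex.sq_norm, normSq_apply] at h
    linarith
  have hn : z.re ^ 2 + z.im ^ 2 ≤ 1 / 4 := by nlinarith
  have hx : -(1 / 2) ≤ z.re :=
    abs_le_of_sq_le_sq' (by nlinarith [sq_nonneg z.im]) (by norm_num) |>.1
  set w : ℂ := (1 + z + z ^ 2) * (1 + (starRingEnd ℂ) z) with hw
  have hwre : w.re = 1 + 2 * z.re + 2 * z.re ^ 2 + z.re * (z.re ^ 2 + z.im ^ 2) := by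
    simp [hw, pow_two]; ring
  have hwim : w.im = z.im * (2 * z.re + (z.re ^ 2 + z.im ^ 2)) := by
    simp [hw, pow_two]; ring
  have hwpos : 0 < w.re := by
    rw [hwre]
    nlinarith [sq_nonneg (z.re + 1 / 2), add_nonneg (sq_nonneg z.re) (sq_nonneg z.im)]
  have hw0 : w ≠ 0 := fun h ↦ by simp [h] at hwpos
  have hargw : |arg w| ≤ Real.arctan T := by
    refine abs_arg_le_arctan hwpos ?_
    rw [hwre, hwim, abs_le]
    have h1 := cubic_nonneg_of_quadratic_nonneg hT hρ0 hc hxy (hQ _ _)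
    have h2 := cubic_nonneg_of_quadratic_nonneg (x := z.re) (y := -z.im) hT hρ0 hc
      (by simpa using hxy) (hQ _ _)
    rw [neg_sq] at h2
    constructor <;> linarith
  have h2re : 0 < (1 - z ^ 2).re := by
    simp [pow_two]; nlinarith [sq_nonneg z.im]
  have h20 : 1 - z ^ 2 ≠ 0 := fun h ↦ by simp [h] at h2re
  have hmul : (1 - z ^ 2) * w = (normSq (1 + z) : ℂ) * (1 - z ^ 3) := by
    rw [normSq_eq_conj_mul_self, hw, map_add, map_one]; ring
  have hns : 0 < normSq (1 + z) := by
    rw [normSq_pos]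
    intro h
    have := congrArg re h
    simp at this
    linarith
  have harg2 := abs_lt.1 (abs_arg_lt_pi_div_two_iff.2 (Or.inl h2re))
  have hargw2 := abs_lt.1 (abs_arg_lt_pi_div_two_iff.2 (Or.inl hwpos))
  have hadd : arg ((1 - z ^ 2) * w) = arg (1 - z ^ 2) + arg w :=
    arg_mul h20 hw0 ⟨by linarith, by linarith⟩
  rw [hmul, arg_real_mul _ hns] at hadd
  rwa [hadd, add_sub_cancel_left]

lemma Real.arctan_le_of_le_tan {x φ : ℝ} (h0 : 0 ≤ φ) (h1 : φ < Real.pi / 2)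
    (h : x ≤ Real.tan φ) : Real.arctan x ≤ φ := by
  rw [← Real.arctan_tan (x := φ) (by linarith) h1]
  exact Real.arctan_strictMono.monotone h

lemma Real.arctan_le_self_of_lt_one {x : ℝ} (h0 : 0 ≤ x) (h1 : x < 1) : Real.arctan x ≤ x :=
  have hx : x < Real.pi / 2 := by linarith [Real.pi_gt_three]
  Real.arctan_le_of_le_tan h0 hx (Real.le_tan h0 hx)

lemma Real.arctan_numeric_bound : Real.arctan (791 / 2000) ≤ 377 / 1000 := by
  refine Real.arctan_le_of_le_tan (by norm_num) (by linarith [Real.pi_gt_three]) ?_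
  have hs := Real.sin_gt_sub_cube (x := 377 / 1000) (by norm_num)
  have hc := (abs_le.1 (Real.cos_bound (x := 377 / 1000) (by norm_num [abs_of_pos]))).2
  rw [abs_of_pos (by norm_num)] at hc
  have hpos : 0 < Real.cos (377 / 1000) :=
    Real.cos_pos_of_mem_Ioo ⟨by linarith [Real.pi_gt_three], by linarith [Real.pi_gt_three]⟩
  rw [Real.tan_eq_sin_div_cos, le_div_iff₀ hpos]
  norm_num at hs hc
  linarith

lemma abs_arg_one_sub_le {w : ℂ} {q : ℝ} (hq : q ≤ 1 / 121) (hw : ‖w‖ ≤ q) :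
    |arg (1 - w)| ≤ 201 / 200 * q := by
  have h0 := norm_nonneg w
  have h1 := norm_log_one_add_le (z := -w) (by rw [norm_neg]; linarith)
  rw [← log_im]
  refine (abs_im_le_norm _).trans ?_
  rw [← sub_eq_add_neg, norm_neg] at h1
  refine h1.trans ?_
  have h2 : (1 - ‖w‖)⁻¹ ≤ 121 / 120 := by
    rw [inv_le_comm₀ (by linarith) (by norm_num)]; linarith
  have h3 : ‖w‖ ^ 2 * (1 - ‖w‖)⁻¹ ≤ ‖w‖ ^ 2 * (121 / 120) := by gcongr
  nlinarith

/-- A bound, at primes `p`, for `|arg (1 - z ^ 3) - arg (1 - z ^ 2)|` when `‖z‖ ≤ 1 / p`.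
It is supported on `2, 3, 5, 7` and integers that are prime to `210`. -/
def argBound (n : ℕ) : ℚ :=
  if n = 2 then 377 / 1000 else if n = 3 then 293 / 2000 else if n = 5 then 468 / 10000
  else if n = 7 then 228 / 10000
  else if 11 ≤ n ∧ n.Coprime 210 then 201 / 200 * (1 / n ^ 2 + 1 / n ^ 3) else 0

lemma argBound_nonneg (n : ℕ) : 0 ≤ argBound n := by
  unfold argBound
  split_ifs <;> positivity

lemma abs_arg_sub_arg_le_argBound {p : ℕ} (hp : p.Prime) {z : ℂ} (hz : ‖z‖ ≤ 1 / p) :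
    |arg (1 - z ^ 3) - arg (1 - z ^ 2)| ≤ argBound p := by
  by_cases h2 : p = 2
  · subst h2
    norm_num [argBound] at hz ⊢
    refine (abs_arg_sub_arg_le_arctan (ρ := 1 / 2) (T := 791 / 2000) (c := 1) (by norm_num)
      (by norm_num) (by norm_num) (by norm_num) hz fun x y ↦ ?_).trans Real.arctan_numeric_bound
    nlinarith [sq_nonneg (y - (x + 1 / 8)), sq_nonneg (x + 4045 / 10000)]
  by_cases h3 : p = 3
  · subst h3
    norm_num [argBound] at hz ⊢
    refine (abs_arg_sub_arg_le_arctan (ρ := 1 / 3) (T := 293 / 2000) (c := 209 / 200)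
      (by norm_num) (by norm_num) (by norm_num) (by norm_num) hz fun x y ↦ ?_).trans
      (Real.arctan_le_self_of_lt_one (by norm_num) (by norm_num))
    nlinarith [sq_nonneg (y - (x + 1 / 18) / (209 / 200)), sq_nonneg (x + 1 / 4)]
  by_cases h5 : p = 5
  · subst h5
    norm_num [argBound] at hz ⊢
    refine (abs_arg_sub_arg_le_arctan (ρ := 1 / 5) (T := 117 / 2500) (c := 209 / 200)
      (by norm_num) (by norm_num) (by norm_num) (by norm_num) hz fun x y ↦ ?_).trans
      (Real.arctan_le_self_of_lt_one (by norm_num) (by norm_num))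
    nlinarith [sq_nonneg (y - (x + 1 / 50) / (209 / 200)), sq_nonneg (x + 31 / 200)]
  by_cases h7 : p = 7
  · subst h7
    norm_num [argBound] at hz ⊢
    refine (abs_arg_sub_arg_le_arctan (ρ := 1 / 7) (T := 57 / 2500) (c := 209 / 200)
      (by norm_num) (by norm_num) (by norm_num) (by norm_num) hz fun x y ↦ ?_).trans
      (Real.arctan_le_self_of_lt_one (by norm_num) (by norm_num))
    nlinarith [sq_nonneg (y - (x + 1 / 98) / (209 / 200)), sq_nonneg (x + 1 / 10)]
  have h11 : 11 ≤ p := by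
    by_contra! h
    interval_cases p <;> simp_all +decide
  have hcop : p.Coprime 210 := by
    rw [Nat.Prime.coprime_iff_not_dvd hp]
    intro h
    have h' : p ∣ 2 * 3 * 5 * 7 := h
    simp only [hp.dvd_mul, Nat.prime_dvd_prime_iff_eq hp Nat.prime_two,
      Nat.prime_dvd_prime_iff_eq hp Nat.prime_three, Nat.prime_dvd_prime_iff_eq hp Nat.prime_five,
      Nat.prime_dvd_prime_iff_eq hp Nat.prime_seven] at h'
    omega
  have h11' : (11 : ℝ) ≤ p := by exact_mod_cast h11
  have hq : (1 : ℝ) / p ≤ 1 / 11 := one_div_le_one_div_of_le (by norm_num) h11'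
  have hq0 : (0 : ℝ) ≤ 1 / p := by positivity
  have e2 := abs_arg_one_sub_le (w := z ^ 2) (q := (1 / p) ^ 2) (by nlinarith)
    (by rw [norm_pow]; gcongr)
  have hcube : ((1 : ℝ) / p) ^ 3 ≤ (1 / 11) ^ 3 := by gcongr
  have e3 := abs_arg_one_sub_le (w := z ^ 3) (q := (1 / p) ^ 3) (by linarith)
    (by rw [norm_pow]; gcongr)
  rw [argBound, if_neg h2, if_neg h3, if_neg h5, if_neg h7, if_pos ⟨h11, hcop⟩]
  refine (abs_sub _ _).trans ?_
  push_cast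
  simp only [one_div, inv_pow] at e2 e3 ⊢
  linarith

lemma argBound_le_telescope {n : ℕ} (hn : 200 ≤ n) :
    argBound n ≤ 102 / 100 * (1 / (4 * (n / 2 : ℕ)) - 1 / (4 * ((n + 1) / 2 : ℕ))) := by
  have hne : n ≠ 2 ∧ n ≠ 3 ∧ n ≠ 5 ∧ n ≠ 7 := by omega
  simp only [argBound, hne.1, hne.2.1, hne.2.2.1, hne.2.2.2, if_false]
  obtain ⟨m, rfl | rfl⟩ := Nat.even_or_odd' n
  · rw [if_neg, show (2 * m + 1) / 2 = m by omega, show 2 * m / 2 = m by omega]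
    · simp
    · rintro ⟨-, h⟩
      exact absurd (h.of_dvd (Dvd.intro m rfl) (by norm_num : 2 ∣ 210)) (by norm_num)
  · rw [show (2 * m + 1 + 1) / 2 = m + 1 by omega, show (2 * m + 1) / 2 = m by omega]
    have hm : (100 : ℚ) ≤ m := by exact_mod_cast (by omega : 100 ≤ m)
    have hR : (1 : ℚ) / (4 * (m : ℚ)) - 1 / (4 * ((m + 1 : ℕ) : ℚ)) = 1 / (4 * m * (m + 1)) := by
      push_cast; field_simp; ring
    rw [hR]
    clear hn hne hR
    have h0 : (1 : ℚ) / (2 * m + 1) ^ 2 ≤ 1 / (4 * m * (m + 1)) :=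
      one_div_le_one_div_of_le (by positivity) (by nlinarith)
    have h3 : (1 : ℚ) / (2 * m + 1) ^ 3 ≤ 1 / 200 * (1 / (2 * m + 1) ^ 2) := by
      rw [one_div_mul_one_div]
      apply one_div_le_one_div_of_le (by positivity)
      rw [pow_succ _ 2, mul_comm]
      gcongr
      linarith
    split_ifs
    · have hY : (0 : ℚ) ≤ 1 / (4 * m * (m + 1)) := by positivity
      push_cast
      linarith
    · positivity

set_option maxRecDepth 100000 in
set_option maxHeartbeats 4000000 in
lemma sum_range_argBound_le : ∑ n ∈ Finset.range 200, argBound n ≤ 6255 / 10000 := by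
  norm_num [Finset.sum_range_succ, argBound]

lemma sum_argBound_le (n : ℕ) : ∑ i ∈ Finset.range n, argBound i ≤ 6281 / 10000 := by
  have h (k : ℕ) : ∑ i ∈ Finset.range (200 + k), argBound i ≤
      6255 / 10000 + 102 / 100 * (1 / 400 - 1 / (4 * ((200 + k) / 2 : ℕ))) := by
    induction k with
    | zero => exact sum_range_argBound_le.trans (by norm_num)
    | succ k ih =>
      rw [← add_assoc, Finset.sum_range_succ]
      linarith [argBound_le_telescope (n := 200 + k) (by omega)]
  have hmono : ∑ i ∈ Finset.range n, argBound i ≤ ∑ i ∈ Finset.range (200 + n), argBound i :=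
    Finset.sum_le_sum_of_subset_of_nonneg (Finset.range_subset_range.2 (by omega))
      fun i _ _ ↦ argBound_nonneg i
  have hpos : (0 : ℚ) ≤ 1 / (4 * ((200 + n) / 2 : ℕ)) := by positivity
  linarith [h n]

lemma summable_primes_cpow_neg {s : ℂ} (hs : 1 < s.re) :
    Summable fun p : Nat.Primes ↦ (p : ℂ) ^ (-s) :=
  (summable_riemannZetaSummand hs).of_norm.subtype Nat.Prime

/-- For `1 < re s`, the ratio `ζ(2s) / ζ(3s)` is the exponential of a number whose imaginary part
is less than `π / 5` in absolute value. -/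
lemma exists_riemannZeta_two_mul_eq_exp_mul {s : ℂ} (hs : 1 < s.re) :
    ∃ w : ℂ, |w.im| < Real.pi / 5 ∧
      riemannZeta (2 * s) = exp w * riemannZeta (3 * s) := by
  have hs2 : 1 < (2 * s).re := by simp; linarith
  have hs3 : 1 < (3 * s).re := by simp; linarith
  have hpow (p : Nat.Primes) (k : ℕ) : (p : ℂ) ^ (-(k * s)) = ((p : ℂ) ^ (-s)) ^ k := by
    rw [← cpow_nat_mul, mul_neg]
  have hsum2 := (summable_primes_cpow_neg hs2).clog_one_sub
  have hsum3 := (summable_primes_cpow_neg hs3).clog_one_sub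
  have hsum := hsum3.sub hsum2
  refine ⟨∑' p : Nat.Primes, (log (1 - (p : ℂ) ^ (-(3 * s))) - log (1 - (p : ℂ) ^ (-(2 * s)))),
    ?_, ?_⟩
  · have hterm (p : Nat.Primes) :
        |(log (1 - (p : ℂ) ^ (-(3 * s))) - log (1 - (p : ℂ) ^ (-(2 * s)))).im| ≤
          (argBound p : ℝ) := by
      have h2 := hpow p 2
      have h3 := hpow p 3
      push_cast at h2 h3
      rw [sub_im, log_im, log_im, h2, h3]
      refine abs_arg_sub_arg_le_argBound p.2 ?_
      rw [norm_natCast_cpow_of_pos p.2.pos, neg_re, one_div, ← Real.rpow_neg_one]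
      exact Real.rpow_le_rpow_of_exponent_le (by exact_mod_cast p.2.one_le) (by linarith)
    have hnn (n : ℕ) : (0 : ℝ) ≤ argBound n := by exact_mod_cast argBound_nonneg n
    have hle (n : ℕ) : ∑ i ∈ Finset.range n, (argBound i : ℝ) ≤ 6281 / 10000 := by
      have := sum_argBound_le n
      have h : ((∑ i ∈ Finset.range n, argBound i : ℚ) : ℝ) ≤ ((6281 / 10000 : ℚ) : ℝ) := by
        exact_mod_cast this
      push_cast at h
      exact h
    have hsB : Summable fun n : ℕ ↦ (argBound n : ℝ) := summable_of_sum_range_le hnn hle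
    have hsBP : Summable fun p : Nat.Primes ↦ (argBound p : ℝ) := hsB.subtype Nat.Prime
    rw [← imCLM_apply, imCLM.map_tsum hsum, ← Real.norm_eq_abs]
    calc _ ≤ ∑' p : Nat.Primes, (argBound p : ℝ) := tsum_of_norm_bounded hsBP.hasSum hterm
      _ ≤ ∑' n : ℕ, (argBound n : ℝ) :=
        Summable.tsum_subtype_le (fun n : ℕ ↦ (argBound n : ℝ)) {n | Nat.Prime n} hnn hsB
      _ ≤ 6281 / 10000 := Real.tsum_le_of_sum_range_le hnn hle
      _ < Real.pi / 5 := by linarith [Real.pi_gt_d4]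
  · rw [← riemannZeta_eulerProduct_exp_log hs2, ← riemannZeta_eulerProduct_exp_log hs3, ← exp_add,
      hsum3.tsum_sub hsum2, tsum_neg, tsum_neg]
    congr 1
    ring

/-- **Theorem.** For every integer `1 ≤ k ≤ 5`, `ζ(2s)^k + ζ(3s)^k` has no zeros
in the half-plane `Re s > 1`. -/
theorem zeta_pow_two_three_no_zeros (k : ℕ) (hk1 : 1 ≤ k) (hk5 : k ≤ 5) :
    ∀ s : ℂ, 1 < s.re → riemannZeta (2 * s) ^ k + riemannZeta (3 * s) ^ k ≠ 0 := by
  intro s hs h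
  obtain ⟨w, hw, hζ⟩ := exists_riemannZeta_two_mul_eq_exp_mul hs
  have h3 : riemannZeta (3 * s) ≠ 0 :=
    riemannZeta_ne_zero_of_one_lt_re (by simp; linarith)
  rw [hζ, mul_pow, ← add_one_mul, mul_eq_zero, or_iff_left (pow_ne_zero k h3), ← exp_nat_mul] at h
  have him : |(k * w).im| < Real.pi := by
    have hk : (k : ℝ) ≤ 5 := by exact_mod_cast hk5
    rw [← ofReal_natCast, im_ofReal_mul, abs_mul, Nat.abs_cast]
    nlinarith [abs_nonneg w.im]
  rw [abs_lt] at him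
  have hlog := log_exp him.1 him.2.le
  rw [eq_neg_of_add_eq_zero_left h, log_neg_one] at hlog
  have := congrArg im hlog
  rw [mul_I_im, ofReal_re] at this
  linarith
end

section
/- Let r > 1 be a real number, let θ ∈ ℝ satisfy cos θ = −1/(2r), and set z = r e^{iθ}. Then (z³ − z)/(z³ − 1) is a positive real number equal to r²/(r² − 1). -/
open Complex

/-- A complex number `z = r e^{iθ}` is a root of `X² - 2 r cos θ X + r²`. -/
lemma polar_sq_add_sq (r θ : ℝ) :
    ((r : ℂ) * exp (θ * I)) ^ 2 + (r : ℂ) ^ 2 =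
      ((2 * r * Real.cos θ : ℝ) : ℂ) * ((r : ℂ) * exp (θ * I)) := by
  rw [exp_mul_I]
  push_cast
  linear_combination (r : ℂ) ^ 2 * sin θ ^ 2 * I_sq - (r : ℂ) ^ 2 * sin_sq_add_cos_sq (θ : ℂ)

/-- Let `r > 1`, let `θ ∈ ℝ` with `cos θ = −1/(2r)`, and set `z = r e^{iθ}`. Then
`(z³ − z)/(z³ − 1)` is a positive real number equal to `r²/(r² − 1)`. -/
theorem crossing_real_axis (r : ℝ) (hr : 1 < r) (θ : ℝ) (hθ : Real.cos θ = -1 / (2 * r)) :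
    0 < r ^ 2 / (r ^ 2 - 1) ∧
    ((r : ℂ) * exp (θ * I)) ^ 3 - (r : ℂ) * exp (θ * I) ≠ 0 ∧
    (((r : ℂ) * exp (θ * I)) ^ 3 - (r : ℂ) * exp (θ * I)) /
      (((r : ℂ) * exp (θ * I)) ^ 3 - 1) = ((r ^ 2 / (r ^ 2 - 1) : ℝ) : ℂ) := by
  have hr0 : r ≠ 0 := by positivity
  have hr1 : 0 < r ^ 2 - 1 := by nlinarith
  have hcos : 2 * r * Real.cos θ = -1 := by
    rw [hθ]
    field_simp
  have hz := polar_sq_add_sq r θ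
  rw [hcos] at hz
  generalize (r : ℂ) * exp (θ * I) = z at hz ⊢
  push_cast at hz
  have hrC : (r : ℂ) ≠ 0 := mod_cast hr0
  have hr1C : (r : ℂ) ^ 2 - 1 ≠ 0 := mod_cast hr1.ne'
  have hz1 : z - 1 ≠ 0 := by
    intro h
    have h2 : (r : ℂ) ^ 2 + 2 = 0 := by linear_combination hz - (z + 2) * h
    have h3 : r ^ 2 + 2 = 0 := mod_cast h2
    nlinarith
  have hnum : z ^ 3 - z = -(r : ℂ) ^ 2 * (z - 1) := by linear_combination (z - 1) * hz
  have hden : z ^ 3 - 1 = -((r : ℂ) ^ 2 - 1) * (z - 1) := by linear_combination (z - 1) * hz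
  refine ⟨by positivity, ?_, ?_⟩
  · rw [hnum]
    exact mul_ne_zero (neg_ne_zero.mpr (pow_ne_zero 2 hrC)) hz1
  · rw [hnum, hden, mul_div_mul_right _ _ hz1, neg_div_neg_eq]
    push_cast
    rfl
end

section
/- For every real number r ≥ 2 and every θ ∈ ℝ with cos θ ≥ −1/(2r), one has 2r(8 + 31r² + 17r⁴)cos θ + 4(1 + 7r² + 8r⁴)cos(2θ) + r((7 + 16r²)cos(3θ) + r(24 + 35r² + 8r⁴ + 4cos(4θ))) > 0. -/
/-- For every real `r ≥ 2` and every `θ` with `cos θ ≥ −1/(2r)`, the displayed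
trigonometric expression (minus the numerator of the derivative of the slope of the
curve `g(re^{iθ})`) is positive. -/
theorem slope_numerator_positive (r θ : ℝ) (hr : 2 ≤ r) (hθ : -1 / (2 * r) ≤ Real.cos θ) :
    0 < 2 * r * (8 + 31 * r ^ 2 + 17 * r ^ 4) * Real.cos θ
      + 4 * (1 + 7 * r ^ 2 + 8 * r ^ 4) * Real.cos (2 * θ)
      + r * ((7 + 16 * r ^ 2) * Real.cos (3 * θ)
          + r * (24 + 35 * r ^ 2 + 8 * r ^ 4 + 4 * Real.cos (4 * θ))) := by
  have hs : 4 ≤ r ^ 2 := by nlinarith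
  have hx : 0 ≤ r * Real.cos θ + 1 / 2 := by
    rw [div_le_iff₀ (by linarith)] at hθ
    linarith
  have h4 : Real.cos (4 * θ) = 2 * (2 * Real.cos θ ^ 2 - 1) ^ 2 - 1 := by
    rw [show 4 * θ = 2 * (2 * θ) by ring, Real.cos_two_mul, Real.cos_two_mul]
  rw [h4, Real.cos_two_mul, Real.cos_three_mul]
  generalize Real.cos θ = c at *
  have hcubic : 0 ≤ (28 + 64 * r ^ 2) * c ^ 2 * (r * c + 1 / 2) := by positivity
  have hquad : 0 ≤ c ^ 2 * (64 * (r ^ 2) ^ 2 - 8 * r ^ 2 - 6) :=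
    mul_nonneg (sq_nonneg c) (by nlinarith)
  have hlin : 0 ≤ (34 * (r ^ 2) ^ 2 + 14 * r ^ 2 - 5) * (r * c + 1 / 2) :=
    mul_nonneg (by nlinarith) hx
  have hquartic : 0 ≤ 32 * r ^ 2 * c ^ 4 := by positivity
  have hconst : 0 < 8 * (r ^ 2) ^ 3 - 14 * (r ^ 2) ^ 2 - 7 * r ^ 2 - 3 / 2 := by
    nlinarith [mul_nonneg (sq_nonneg (r ^ 2)) (sub_nonneg.2 hs)]
  linarith
end
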